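/- In the event-based graph, every directed cycle through the depot node (0,…,0) that contains a pick-up node of request i also contains a drop-off node of request i, and the drop-off node occurs after the pick-up node on the cycle (before returning to the depot). Hence pairing and precedence constraints hold implicitly for any tour in the event-based graph. -/

import Mathlib

namespace DARP14

abbrev Rest (n Q : ℕ) := Fin (Q - 1) → WithBot (Fin n)

/-- A node of the event-based graph: the depot `none`, or a pick-up (`true`) / drop-off
(`false`) event of a request together with the seat allocation tuple. -/
abbrev Node (n Q : ℕ) := Option (Bool × Fin n × Rest n Q)

def seated {n Q : ℕ} (r : Rest n Q) : Set (Fin n) :=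
  {k | ∃ l, r l = (k : WithBot (Fin n))}

/-- Node validity: seat entries avoid the event user, nonzero entries distinct. -/
def Valid {n Q : ℕ} : Node n Q → Prop
  | none => True
  | some (_, i, r) => (∀ l, r l ≠ (i : WithBot (Fin n))) ∧
      (∀ l l', r l ≠ ⊥ → r l = r l' → l = l')

/-- The arc relation of the event-based graph, given by the six arc classes
`A_1, …, A_6`. -/
def Arc {n Q : ℕ} : Node n Q → Node n Q → Prop
  | none, none => False
  -- A₆ : depot to pick-up
  | none, some w => ∃ i : Fin n, w = (true, i, fun _ => ⊥)
  -- A₅ : drop-off to depot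
  | some v, none => ∃ i : Fin n, v = (false, i, fun _ => ⊥)
  | some v, some w =>
    -- A₁ : pick-up to drop-off
    (∃ (i j : Fin n) (r r' : Rest n Q), v = (true, i, r) ∧ w = (false, j, r') ∧
        seated r' ∪ {j} = seated r ∪ {i}) ∨
    -- A₂ : pick-up to pick-up
    (∃ (i j : Fin n) (r r' : Rest n Q), v = (true, i, r) ∧ w = (true, j, r') ∧
        (∀ h : Q - 2 < Q - 1, r ⟨Q - 2, h⟩ = ⊥) ∧ seated r' = seated r ∪ {i}) ∨
    -- A₃ : drop-off to pick-up
    (∃ (i j : Fin n) (r : Rest n Q), v = (false, i, r) ∧ w = (true, j, r) ∧ i ≠ j) ∨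
    -- A₄ : drop-off to drop-off
    (∃ (i j : Fin n) (r r' : Rest n Q), v = (false, i, r) ∧ w = (false, j, r') ∧
        (∀ h : Q - 2 < Q - 1, r' ⟨Q - 2, h⟩ = ⊥) ∧ seated r = seated r' ∪ {j})

/-- User `i` is on board when the vehicle leaves the given node. -/
def OnBoard {n Q : ℕ} (i : Fin n) : Node n Q → Prop
  | none => False
  | some (b, j, r) => (b = true ∧ j = i) ∨ i ∈ seated r

theorem notMem_seated_bot {n Q : ℕ} (i : Fin n) :
    i ∉ seated (fun _ => ⊥ : Rest n Q) := by
  rintro ⟨_, h⟩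
  exact WithBot.bot_ne_coe h

/-- Along an arc, a user on board stays on board unless the arc enters one of their
drop-off nodes. -/
theorem Arc.onBoard_or_dropOff {n Q : ℕ} {i : Fin n} {v w : Node n Q} (h : Arc v w)
    (hv : OnBoard i v) : OnBoard i w ∨ ∃ r : Rest n Q, w = some (false, i, r) := by
  rcases v with _ | v
  · exact hv.elim
  rcases w with _ | w
  · obtain ⟨j, rfl⟩ := h
    rcases hv with ⟨hb, -⟩ | hi
    · exact absurd hb (by simp)
    · exact absurd hi (notMem_seated_bot i)
  have mem_dropOff {j : Fin n} {r' : Rest n Q} (hi : i ∈ seated r' ∪ {j}) :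
      OnBoard i (some (false, j, r')) ∨
        ∃ r : Rest n Q, (some (false, j, r') : Node n Q) = some (false, i, r) := by
    rcases hi with hi | rfl
    · exact Or.inl (Or.inr hi)
    · exact Or.inr ⟨r', rfl⟩
  have mem_pickUp {j : Fin n} {r : Rest n Q} (hj : OnBoard i (some (true, j, r))) :
      i ∈ seated r ∪ {j} := by
    rcases hj with ⟨-, rfl⟩ | hi
    · exact Or.inr rfl
    · exact Or.inl hi
  have mem_of_dropOff {j : Fin n} {r : Rest n Q} (hj : OnBoard i (some (false, j, r))) :
      i ∈ seated r := by
    rcases hj with ⟨hb, -⟩ | hi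
    · exact absurd hb (by simp)
    · exact hi
  rcases h with ⟨j, l, r, r', rfl, rfl, hs⟩ | ⟨j, l, r, r', rfl, rfl, -, hs⟩ |
    ⟨j, l, r, rfl, rfl, -⟩ | ⟨j, l, r, r', rfl, rfl, -, hs⟩
  · exact mem_dropOff (hs ▸ mem_pickUp hv)
  · exact Or.inl (Or.inr (hs ▸ mem_pickUp hv))
  · exact Or.inl (Or.inr (mem_of_dropOff hv))
  · exact mem_dropOff (hs ▸ mem_of_dropOff hv)

/-- every directed cycle through the depot that contains a pick-up node of
request `i` also contains a drop-off node of request `i`, occurring after the pick-up node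
(before returning to the depot): pairing and precedence hold implicitly. -/
theorem pairing_precedence {n Q : ℕ} (m : ℕ) (hm : 1 ≤ m) (c : ℕ → Node n Q)
    (h0 : c 0 = none) (hend : c m = none)
    (hvalid : ∀ k ≤ m, Valid (c k))
    (harc : ∀ k < m, Arc (c k) (c (k + 1))) (i : Fin n) :
    ∀ k ≤ m, ∀ r : Rest n Q, c k = some (true, i, r) →
      ∃ k', k < k' ∧ k' ≤ m ∧ ∃ r' : Rest n Q, c k' = some (false, i, r') := by
  intro k hk r hr
  by_contra! hno
  have onBoard : ∀ l, k ≤ l → l ≤ m → OnBoard i (c l) := by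
    intro l hl
    induction l, hl using Nat.le_induction with
    | base => exact fun _ => hr ▸ Or.inl ⟨rfl, rfl⟩
    | succ l hl ih =>
      intro hlm
      rcases (harc l hlm).onBoard_or_dropOff (ih (by lia)) with h | ⟨r', h⟩
      · exact h
      · exact absurd h (hno (l + 1) (by lia) hlm r')
  have hm' := onBoard m hk le_rfl
  rw [hend] at hm'
  exact hm'

end DARP14
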